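/- arXiv:2503.03991 — 2 statements merged into one kernel-verified Lean document; each statement's English description precedes it below -/
import Mathlib

section
/- Let v : ℝ³ → ℝ³ be a continuous vector field that vanishes at infinity (v(x) → 0 along the cocompact filter), let Ω = {x ∈ ℝ³ : curl v (x) = 0} where v is continuously differentiable, and suppose that on the interior of Ω the field v is smooth with curl v = 0 and div v = 0, and that the frontier of Ω is nonempty. Then the supremum over x ∈ Ω of ‖v(x)‖² is at most the supremum over x in the frontier of Ω of ‖v(x)‖². -/
noncomputable section

open Set Filter Topology
open scoped ENNReal RealInnerProductSpace

abbrev E3 : Type := EuclideanSpace ℝ (Fin 3)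

/-- The `i`-th standard basis vector of `ℝ³`. -/
def ee (i : Fin 3) : E3 := EuclideanSpace.single i 1

/-- Partial derivative in the `i`-th coordinate direction. -/
def pd {F : Type*} [NormedAddCommGroup F] [NormedSpace ℝ F]
    (i : Fin 3) (f : E3 → F) (x : E3) : F :=
  fderiv ℝ f x (ee i)

/-- Divergence of a vector field on `ℝ³`. -/
def div3 (v : E3 → E3) (x : E3) : ℝ := ∑ i, pd i v x i

/-- Componentwise Laplacian of a vector field on `ℝ³`. -/
def lapVec (v : E3 → E3) (x : E3) : E3 := ∑ i, pd i (fun y => pd i v y) x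

/-- Laplacian of a scalar function on `ℝ³`. -/
def lapSc (f : E3 → ℝ) (x : E3) : ℝ := ∑ i, pd i (fun y => pd i f y) x

/-- Curl of a vector field on `ℝ³`. -/
def curl3 (v : E3 → E3) (x : E3) : E3 :=
  (WithLp.equiv 2 (Fin 3 → ℝ)).symm
    ![pd 1 v x 2 - pd 2 v x 1, pd 2 v x 0 - pd 0 v x 2, pd 0 v x 1 - pd 1 v x 0]

/-- Cross product on `ℝ³`. -/
def cross3 (a b : E3) : E3 :=
  (WithLp.equiv 2 (Fin 3 → ℝ)).symm
    (crossProduct ((WithLp.equiv 2 (Fin 3 → ℝ)) a) ((WithLp.equiv 2 (Fin 3 → ℝ)) b))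

/-- The time interval `[0, T)`, where `T ∈ (0, ∞]`. -/
def TimeDom (T : ℝ≥0∞) : Set ℝ := {t : ℝ | 0 ≤ t ∧ ENNReal.ofReal t < T}

/-- `(u, p)` is a smooth solution of the incompressible Navier–Stokes (`μ > 0`) / Euler
(`μ = 0`) equations on `ℝ³ × [0, T)`:  `u, p` are smooth in `(t, x)` and satisfy pointwise
`∂ₜ u + (u·∇)u − μ Δu + ∇p = 0` and `div u = 0`. -/
def IsNSSolution (μ : ℝ) (T : ℝ≥0∞) (u : ℝ → E3 → E3) (p : ℝ → E3 → ℝ) : Prop :=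
  ContDiffOn ℝ (⊤ : ℕ∞) (fun q : ℝ × E3 => u q.1 q.2) (TimeDom T ×ˢ (univ : Set E3)) ∧
  ContDiffOn ℝ (⊤ : ℕ∞) (fun q : ℝ × E3 => p q.1 q.2) (TimeDom T ×ˢ (univ : Set E3)) ∧
  (∀ t ∈ TimeDom T, ∀ x : E3,
    deriv (fun s => u s x) t + fderiv ℝ (u t) x (u t x)
      - μ • lapVec (u t) x + gradient (p t) x = 0) ∧
  (∀ t ∈ TimeDom T, ∀ x : E3, div3 (u t) x = 0)
/-- At a local maximum the second derivative is nonpositive. -/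
lemma second_deriv_nonpos {f f' : ℝ → ℝ} {c : ℝ} (hf : ∀ t, HasDerivAt f (f' t) t)
    (hf' : HasDerivAt f' c 0) (hmax : IsLocalMax f 0) : c ≤ 0 := by
  by_contra hcon
  push Not at hcon
  have hd : deriv f = f' := funext fun t => (hf t).deriv
  have hmin : IsLocalMin f 0 := by
    apply isLocalMin_of_deriv_deriv_pos
    · rw [hd, hf'.deriv]; exact hcon
    · exact hmax.deriv_eq_zero
    · exact (hf 0).continuousAt
  have hconst : f =ᶠ[𝓝 0] fun _ => f 0 := by
    filter_upwards [hmax, hmin] with t h1 h2 using le_antisymm h1 h2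
  have h1 := hconst.deriv
  rw [hd] at h1
  have h2 := h1.deriv_eq
  rw [hf'.deriv] at h2
  simp at h2
  linarith

lemma curl_sym {v : E3 → E3} {x : E3} (h : curl3 v x = 0) (j k : Fin 3) :
    fderiv ℝ v x (ee j) k = fderiv ℝ v x (ee k) j := by
  have h0 := congrArg (fun w : E3 => w 0) h
  have h1 := congrArg (fun w : E3 => w 1) h
  have h2 := congrArg (fun w : E3 => w 2) h
  simp [curl3, pd] at h0 h1 h2
  fin_cases j <;> fin_cases k <;> simp <;> linarith

/-- A curl-free, divergence-free smooth field has vanishing Laplacian. -/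
lemma lap_zero {v : E3 → E3} {U : Set E3} (hU : IsOpen U)
    (hsm : ContDiffOn ℝ (⊤ : ℕ∞) v U) (hcurl : ∀ x ∈ U, curl3 v x = 0)
    (hdiv : ∀ x ∈ U, div3 v x = 0) {y : E3} (hy : y ∈ U) :
    ∑ i, fderiv ℝ (fderiv ℝ v) y (ee i) (ee i) = 0 := by
  have hat : ContDiffAt ℝ 2 v y :=
    ((hsm.contDiffAt (hU.mem_nhds hy))).of_le (WithTop.coe_le_coe.2 (le_top : (2 : ℕ∞) ≤ ⊤))
  have hdd : HasFDerivAt (fderiv ℝ v) (fderiv ℝ (fderiv ℝ v) y) y :=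
    ((hat.fderiv_right (m := 1) (by norm_num)).differentiableAt (by norm_num)).hasFDerivAt
  have hsym : IsSymmSndFDerivAt ℝ v y := hat.isSymmSndFDerivAt (by simp)
  have hcomp : ∀ j k : Fin 3, HasFDerivAt (fun x => fderiv ℝ v x (ee j) k)
      ((EuclideanSpace.proj k : E3 →L[ℝ] ℝ) ∘L
        ((ContinuousLinearMap.apply ℝ E3 (ee j)) ∘L (fderiv ℝ (fderiv ℝ v) y))) y := by
    intro j k
    exact (EuclideanSpace.proj k : E3 →L[ℝ] ℝ).hasFDerivAt.comp y
      ((ContinuousLinearMap.apply ℝ E3 (ee j)).hasFDerivAt.comp y hdd)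
  have hT : ∀ i j k : Fin 3, fderiv ℝ (fderiv ℝ v) y (ee i) (ee j) k
      = fderiv ℝ (fderiv ℝ v) y (ee i) (ee k) j := by
    intro i j k
    have he : (fun x => fderiv ℝ v x (ee j) k) =ᶠ[𝓝 y] fun x => fderiv ℝ v x (ee k) j := by
      filter_upwards [hU.mem_nhds hy] with x hx using curl_sym (hcurl x hx) j k
    have := he.fderiv_eq (𝕜 := ℝ)
    rw [(hcomp j k).fderiv, (hcomp k j).fderiv] at this
    simpa using congrArg (fun L : E3 →L[ℝ] ℝ => L (ee i)) this
  have hD : ∀ i : Fin 3, ∑ k, fderiv ℝ (fderiv ℝ v) y (ee i) (ee k) k = 0 := by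
    intro i
    have he : (fun x => ∑ k, fderiv ℝ v x (ee k) k) =ᶠ[𝓝 y] fun x => (0 : ℝ) := by
      filter_upwards [hU.mem_nhds hy] with x hx using hdiv x hx
    have := he.fderiv_eq (𝕜 := ℝ)
    rw [(HasFDerivAt.fun_sum fun k _ => hcomp k k).fderiv] at this
    simpa using congrArg (fun L : E3 →L[ℝ] ℝ => L (ee i)) this
  ext k
  rw [← show _ = (0 : E3) k from hD k]
  simp only [WithLp.ofLp_sum, Finset.sum_apply]
  refine Finset.sum_congr rfl fun i _ => ?_
  rw [hT i i k, hsym.eq (ee i) (ee k)]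

/-- The perturbed linear functional of `v` has no local maximum in `U`. -/
lemma no_local_max {v : E3 → E3} (hC1 : ContDiff ℝ 1 v) {U : Set E3} (hU : IsOpen U)
    (hsm : ContDiffOn ℝ (⊤ : ℕ∞) v U) (hcurl : ∀ x ∈ U, curl3 v x = 0)
    (hdiv : ∀ x ∈ U, div3 v x = 0) {y : E3} (hy : y ∈ U) (a : E3) {ε : ℝ} (hε : 0 < ε)
    (hmax : IsLocalMax (fun x => ⟪a, v x⟫ + ε * ‖x‖ ^ 2) y) : False := by
  have hat : ContDiffAt ℝ 2 v y :=
    ((hsm.contDiffAt (hU.mem_nhds hy))).of_le (WithTop.coe_le_coe.2 (le_top : (2 : ℕ∞) ≤ ⊤))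
  have hdd : HasFDerivAt (fderiv ℝ v) (fderiv ℝ (fderiv ℝ v) y) y :=
    ((hat.fderiv_right (m := 1) (by norm_num)).differentiableAt (by norm_num)).hasFDerivAt
  have key : ∀ i : Fin 3, ⟪a, fderiv ℝ (fderiv ℝ v) y (ee i) (ee i)⟫ + ε * 2 ≤ 0 := by
    intro i
    have hl : ∀ t : ℝ, HasDerivAt (fun t : ℝ => y + t • ee i) (ee i) t := by
      intro t
      simpa using ((hasDerivAt_id t).smul_const (ee i)).const_add y
    have hn : ‖ee i‖ = 1 := by simp [ee]
    have hf : ∀ t : ℝ, HasDerivAt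
        (fun t : ℝ => ⟪a, v (y + t • ee i)⟫ + ε * ‖y + t • ee i‖ ^ 2)
        (⟪a, fderiv ℝ v (y + t • ee i) (ee i)⟫ + ε * (2 * ⟪y + t • ee i, ee i⟫)) t := by
      intro t
      have h1 := ((hC1.differentiable (by norm_num)) (y + t • ee i)).hasFDerivAt.comp_hasDerivAt t (hl t)
      have h2 := (innerSL ℝ a).hasFDerivAt.comp_hasDerivAt t h1
      exact h2.add ((hl t).norm_sq.const_mul ε)
    have hf' : HasDerivAt
        (fun t : ℝ => ⟪a, fderiv ℝ v (y + t • ee i) (ee i)⟫ + ε * (2 * ⟪y + t • ee i, ee i⟫))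
        (⟪a, fderiv ℝ (fderiv ℝ v) y (ee i) (ee i)⟫ + ε * 2) 0 := by
      have hdd' : HasFDerivAt (fderiv ℝ v) (fderiv ℝ (fderiv ℝ v) y) (y + (0:ℝ) • ee i) := by
        simpa using hdd
      have h1 := hdd'.comp_hasDerivAt (0:ℝ) (hl 0)
      have h2 := ((innerSL ℝ a) ∘L (ContinuousLinearMap.apply ℝ E3 (ee i))).hasFDerivAt.comp_hasDerivAt
        (0:ℝ) h1
      have h3 := (innerSL ℝ (ee i)).hasFDerivAt.comp_hasDerivAt (0:ℝ) (hl 0)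
      have h4 := h2.add ((h3.const_mul 2).const_mul ε)
      refine (h4.congr_deriv ?_).congr_of_eventuallyEq ?_
      · simp [hn]
      · refine Eventually.of_forall fun t => ?_
        simp [real_inner_comm]
    refine second_deriv_nonpos hf hf' ?_
    have hcl : Tendsto (fun t : ℝ => y + t • ee i) (𝓝 0) (𝓝 y) := by
      simpa using (hl 0).continuousAt.tendsto
    have := hcl.eventually hmax
    simpa [IsLocalMax, IsMaxFilter] using this
  have hs := Finset.sum_le_sum fun i (_ : i ∈ Finset.univ) => key i
  rw [Finset.sum_add_distrib, ← inner_sum, lap_zero hU hsm hcurl hdiv hy] at hs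
  simp at hs
  linarith

/-- Weak maximum principle for the squared speed of an irrotational,
divergence-free vector field on its zero-vorticity region. -/
theorem sq_speed_max_principle (v : E3 → E3)
    (hc : Continuous v) (hC1 : ContDiff ℝ 1 v)
    (hvan : Tendsto v (cocompact E3) (𝓝 0))
    (hsm : ContDiffOn ℝ (⊤ : ℕ∞) v (interior {x : E3 | curl3 v x = 0}))
    (hcurl : ∀ x ∈ interior {x : E3 | curl3 v x = 0}, curl3 v x = 0)
    (hdiv : ∀ x ∈ interior {x : E3 | curl3 v x = 0}, div3 v x = 0)
    (hfr : (frontier {x : E3 | curl3 v x = 0}).Nonempty) :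
    (⨆ x : {x : E3 | curl3 v x = 0}, ‖v x.1‖ ^ 2)
      ≤ ⨆ x : frontier {x : E3 | curl3 v x = 0}, ‖v x.1‖ ^ 2 := by
  set Ω : Set E3 := {x : E3 | curl3 v x = 0} with hΩ
  have hclosed : IsClosed Ω := by
    have hfd : ∀ i k : Fin 3, Continuous fun x => pd i v x k := by
      intro i k
      have h1 : Continuous (fderiv ℝ v) := hC1.continuous_fderiv (by norm_num)
      exact (EuclideanSpace.proj k : E3 →L[ℝ] ℝ).continuous.comp (h1.clm_apply continuous_const)
    have : Ω = {x | pd 1 v x 2 - pd 2 v x 1 = 0} ∩ ({x | pd 2 v x 0 - pd 0 v x 2 = 0}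
        ∩ {x | pd 0 v x 1 - pd 1 v x 0 = 0}) := by
      ext x
      simp only [hΩ, mem_inter_iff, mem_setOf_eq]
      constructor
      · intro h
        have h0 := congrArg (fun w : E3 => w 0) h
        have h1 := congrArg (fun w : E3 => w 1) h
        have h2 := congrArg (fun w : E3 => w 2) h
        simp [curl3] at h0 h1 h2
        exact ⟨h0, h1, h2⟩
      · rintro ⟨h0, h1, h2⟩
        ext k
        fin_cases k <;> simp [curl3, h0, h1, h2]
    rw [this]
    exact (isClosed_eq ((hfd 1 2).sub (hfd 2 1)) continuous_const).inter
      ((isClosed_eq ((hfd 2 0).sub (hfd 0 2)) continuous_const).inter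
        (isClosed_eq ((hfd 0 1).sub (hfd 1 0)) continuous_const))
  have hbdd : BddAbove (range fun x : frontier Ω => ‖v x.1‖ ^ 2) := by
    let V : ZeroAtInftyContinuousMap E3 E3 := ⟨⟨v, hc⟩, hvan⟩
    obtain ⟨C, hC⟩ := (ZeroAtInftyContinuousMap.isBounded_range V).exists_norm_le
    refine ⟨C ^ 2, ?_⟩
    rintro _ ⟨x, rfl⟩
    have : ‖v x.1‖ ≤ C := hC (v x.1) ⟨x.1, rfl⟩
    simp only
    gcongr
  set M := ⨆ x : frontier Ω, ‖v x.1‖ ^ 2 with hM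
  have hMF : ∀ z ∈ frontier Ω, ‖v z‖ ^ 2 ≤ M := fun z hz => le_ciSup hbdd ⟨z, hz⟩
  have hM0 : 0 ≤ M := Real.iSup_nonneg fun x => by positivity
  refine Real.iSup_le (fun x0 => ?_) hM0
  obtain ⟨x0, hx0⟩ := x0
  simp only
  by_contra hcon
  push Not at hcon
  set s := ‖v x0‖ with hs
  have hspos : 0 < s := by
    rcases (norm_nonneg (v x0)).lt_or_eq with h | h
    · exact h
    · rw [← hs] at h; rw [← h] at hcon; norm_num at hcon; linarith
  obtain ⟨R, hR⟩ : ∃ R : ℝ, ∀ x : E3, R ≤ ‖x‖ → ‖v x‖ < s / 2 := by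
    have h1 : ∀ᶠ x in cocompact E3, ‖v x‖ < s / 2 := by
      have := hvan.norm
      rw [norm_zero] at this
      exact this.eventually (gt_mem_nhds (by positivity))
    rw [← Metric.cobounded_eq_cocompact, (hasBasis_cobounded_norm (E := E3)).eventually_iff] at h1
    obtain ⟨R, -, h⟩ := h1
    exact ⟨R, fun x hx => h hx⟩
  have hx0R : ‖x0‖ < R := by
    by_contra h
    push Not at h
    have := hR x0 h
    linarith
  have hRpos : 0 < R := (norm_nonneg _).trans_lt hx0R
  set m := max (√M) (s / 2) with hm
  have hms : m < s := max_lt ((Real.sqrt_lt' hspos).2 hcon) (by linarith)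
  set ε := (s ^ 2 - m * s) / (2 * (R ^ 2 + 1)) with hε
  have hgap : 0 < s ^ 2 - m * s := by nlinarith
  have hεpos : 0 < ε := by positivity
  have hεR : ε * R ^ 2 < s ^ 2 - m * s := by
    have : ε * (2 * (R ^ 2 + 1)) = s ^ 2 - m * s := by
      rw [hε]; field_simp
    nlinarith [sq_nonneg R]
  have hK : IsCompact (Ω ∩ Metric.closedBall 0 R) :=
    (isCompact_closedBall (0 : E3) R).inter_left hclosed
  obtain ⟨y, hyK, hymax⟩ := hK.exists_isMaxOn
    (f := fun x => ⟪v x0, v x⟫ + ε * ‖x‖ ^ 2) ⟨x0, hx0, by simpa using hx0R.le⟩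
    (by fun_prop)
  have hfy : s ^ 2 ≤ ⟪v x0, v y⟫ + ε * ‖y‖ ^ 2 := by
    have h := hymax (show x0 ∈ Ω ∩ Metric.closedBall 0 R from ⟨hx0, by simpa using hx0R.le⟩)
    simp only [mem_setOf_eq, real_inner_self_eq_norm_sq] at h
    have : 0 ≤ ε * ‖x0‖ ^ 2 := by positivity
    linarith
  have hyR : ‖y‖ ≤ R := by simpa using hyK.2
  have hbig : m < ‖v y‖ := by
    by_contra h
    push Not at h
    have h1 : ⟪v x0, v y⟫ ≤ s * ‖v y‖ := real_inner_le_norm _ _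
    have h2 : s * ‖v y‖ ≤ s * m := by gcongr
    have h3 : ε * ‖y‖ ^ 2 ≤ ε * R ^ 2 := by gcongr
    nlinarith
  have hyR' : ‖y‖ < R := by
    by_contra h
    push Not at h
    have := hR y h
    have := le_max_right (√M) (s / 2)
    linarith
  have hyU : y ∈ interior Ω := by
    by_contra h
    have h1 := hMF y ⟨subset_closure hyK.1, h⟩
    have h2 := Real.le_sqrt_of_sq_le h1
    have := le_max_left (√M) (s / 2)
    linarith
  refine no_local_max hC1 isOpen_interior hsm hcurl hdiv hyU (v x0) hεpos
    (hymax.isLocalMax ?_)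
  refine inter_mem (mem_interior_iff_mem_nhds.1 hyU) (Metric.closedBall_mem_nhds_of_mem ?_)
  simpa using hyR'
end
end

section
/- Let T ∈ (0,∞], μ ≥ 0, and let (u,p) be a smooth solution of the incompressible Navier–Stokes/Euler equations on [0,T) such that u vanishes at spatial infinity. Fix t ∈ [0,T) and suppose the zero-vorticity set Ω_t is not all of ℝ³. Then the supremum over x ∈ Ω_t of ‖u(t,x)‖ is at most the supremum over x in the closure of ℝ³ \ Ω_t of ‖u(t,x)‖. -/
noncomputable section

open Set Filter Topology
open scoped ENNReal RealInnerProductSpace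

lemma pd_pd_eq (v : E3 → E3) (hv : ContDiff ℝ 2 v) (i k j : Fin 3) (z : E3) :
    pd i (fun y => pd k v y j) z = fderiv ℝ (fderiv ℝ v) z (ee i) (ee k) j := by
  have hd : DifferentiableAt ℝ (fderiv ℝ v) z :=
    ((hv.fderiv_right (m := 1) (by norm_num)).differentiable (by norm_num)) z
  have h1 : HasFDerivAt (fun y => fderiv ℝ v y (ee k))
      ((fderiv ℝ (fderiv ℝ v) z).flip (ee k)) z := by
    have := hd.hasFDerivAt.clm_apply (hasFDerivAt_const (ee k) z)
    exact this.congr_fderiv (by simp)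
  have h2 := (EuclideanSpace.proj j : E3 →L[ℝ] ℝ).hasFDerivAt.comp z h1
  have h3 : HasFDerivAt (fun y => pd k v y j) _ z := h2
  unfold pd at h3 ⊢
  rw [h3.fderiv]
  rfl

lemma pd_pd_comm (v : E3 → E3) (hv : ContDiff ℝ 2 v) (i k j : Fin 3) (z : E3) :
    pd i (fun y => pd k v y j) z = pd k (fun y => pd i v y j) z := by
  rw [pd_pd_eq v hv, pd_pd_eq v hv]
  have : IsSymmSndFDerivAt ℝ v z := hv.contDiffAt.isSymmSndFDerivAt (by simp)
  rw [this.eq]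

lemma pd_symm_of_curl {v : E3 → E3} {y : E3} (h : curl3 v y = 0) (i j : Fin 3) :
    pd i v y j = pd j v y i := by
  have h0 := congrArg (fun w : E3 => w 0) h
  have h1 := congrArg (fun w : E3 => w 1) h
  have h2 := congrArg (fun w : E3 => w 2) h
  simp [curl3] at h0 h1 h2
  fin_cases i <;> fin_cases j <;> simp <;> linarith

lemma lap_comp (v : E3 → E3) (hv : ContDiff ℝ 2 v) (hdiv : ∀ x, div3 v x = 0) (z : E3)
    (hc : ∀ᶠ y in 𝓝 z, curl3 v y = 0) (j : Fin 3) :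
    ∑ i, pd i (fun y => pd i v y j) z = 0 := by
  have h1 : ∀ i, pd i (fun y => pd i v y j) z = pd j (fun y => pd i v y i) z := by
    intro i
    rw [← pd_pd_comm v hv i j]
    unfold pd
    rw [Filter.EventuallyEq.fderiv_eq]
    filter_upwards [hc] with y hy
    exact pd_symm_of_curl hy i j
  simp_rw [h1]
  have h2 : (fun y => ∑ i, pd i v y i) = fun _ => (0 : ℝ) := funext hdiv
  have hd : ∀ i : Fin 3, DifferentiableAt ℝ (fun y => pd i v y i) z := by
    intro i
    have hd : DifferentiableAt ℝ (fderiv ℝ v) z :=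
      ((hv.fderiv_right (m := 1) (by norm_num)).differentiable (by norm_num)) z
    have h1 := hd.clm_apply (differentiableAt_const (ee i))
    exact (EuclideanSpace.proj i : E3 →L[ℝ] ℝ).differentiableAt.comp z h1
  have h3 : fderiv ℝ (fun y => ∑ i, pd i v y i) z = ∑ i, fderiv ℝ (fun y => pd i v y i) z :=
    fderiv_fun_sum (fun i _ => hd i)
  rw [h2] at h3
  have h4 := congrArg (fun L : E3 →L[ℝ] ℝ => L (ee j)) h3
  simp only [sum_apply] at h4
  simpa [pd] using h4.symm

lemma second_deriv_nonpos_s6 {f f' : ℝ → ℝ} {c : ℝ} (h1 : ∀ s, HasDerivAt f (f' s) s)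
    (h2 : HasDerivAt f' c 0) (hm : IsLocalMax f 0) : c ≤ 0 := by
  by_contra! hc
  have e : deriv f = f' := funext fun s => (h1 s).deriv
  have hmin : IsLocalMin f 0 := by
    apply isLocalMin_of_deriv_deriv_pos
    · rw [e, h2.deriv]; exact hc
    · exact hm.deriv_eq_zero
    · exact (h1 0).continuousAt
  have hE : f =ᶠ[𝓝 0] fun _ => f 0 := by
    filter_upwards [hm, hmin] with s a b
    exact le_antisymm a b
  have := hE.deriv.deriv_eq
  rw [e, h2.deriv] at this
  simp at this
  linarith

lemma no_local_max_s6 (v : E3 → E3) (hv : ContDiff ℝ 2 v) (hdiv : ∀ x, div3 v x = 0) (z a : E3)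
    (hc : ∀ᶠ y in 𝓝 z, curl3 v y = 0) (ε : ℝ) (hε : 0 < ε)
    (hm : IsLocalMax (fun y => (∑ j, a j * v y j) + ε * ‖y‖ ^ 2) z) : False := by
  have hvd : Differentiable ℝ v := hv.differentiable (by norm_num)
  have hline : ∀ (i : Fin 3) (s : ℝ), HasDerivAt (fun s : ℝ => z + s • ee i) (ee i) s := by
    intro i s
    simpa using ((hasDerivAt_id s).smul_const (ee i)).const_add z
  have key : ∀ i : Fin 3, (∑ j, a j * pd i (fun y => pd i v y j) z) + ε * 2 ≤ 0 := by
    intro i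
    have hee : (⟪ee i, ee i⟫ : ℝ) = 1 := by simp [ee]
    have hnorm : ∀ s : ℝ, ‖z + s • ee i‖ ^ 2 = ‖z‖ ^ 2 + 2 * s * ⟪z, ee i⟫ + s ^ 2 := by
      intro s
      rw [norm_add_sq_real, inner_smul_right, norm_smul, mul_pow, ← real_inner_self_eq_norm_sq (ee i), hee]
      simp
      ring
    refine second_deriv_nonpos_s6
      (f := fun s : ℝ => (∑ j, a j * v (z + s • ee i) j) + ε * ‖z + s • ee i‖ ^ 2)
      (f' := fun s : ℝ => (∑ j, a j * pd i v (z + s • ee i) j) + ε * (2 * ⟪z, ee i⟫ + 2 * s))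
      ?_ ?_ ?_
    · intro s
      apply HasDerivAt.add
      · apply HasDerivAt.fun_sum
        intro j _
        apply HasDerivAt.const_mul
        have h1 := (hvd (z + s • ee i)).hasFDerivAt.comp_hasDerivAt s (hline i s)
        exact (EuclideanSpace.proj j : E3 →L[ℝ] ℝ).hasFDerivAt.comp_hasDerivAt s h1
      · apply HasDerivAt.const_mul
        simp_rw [hnorm]
        have := ((((hasDerivAt_id s).const_mul 2).mul_const (⟪z, ee i⟫ : ℝ)).const_add (‖z‖ ^ 2)).add
          (hasDerivAt_pow 2 s)
        exact this.congr_deriv (by simp)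
    · apply HasDerivAt.add
      · apply HasDerivAt.fun_sum
        intro j _
        apply HasDerivAt.const_mul
        have hd : DifferentiableAt ℝ (fderiv ℝ v) z :=
          ((hv.fderiv_right (m := 1) (by norm_num)).differentiable (by norm_num)) z
        have h1 := hd.clm_apply (differentiableAt_const (ee i))
        have h2 : DifferentiableAt ℝ (fun y => pd i v y j) z :=
          (EuclideanSpace.proj j : E3 →L[ℝ] ℝ).differentiableAt.comp z h1
        have h3 := h2.hasFDerivAt
        exact HasFDerivAt.comp_hasDerivAt_of_eq 0 h3 (hline i 0) (by simp)
      · apply HasDerivAt.const_mul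
        simpa using ((hasDerivAt_id (0 : ℝ)).const_mul 2).const_add (2 * (⟪z, ee i⟫ : ℝ))
    · have ht : Tendsto (fun s : ℝ => z + s • ee i) (𝓝 0) (𝓝 z) := by
        have := (hline i 0).continuousAt.tendsto
        simpa using this
      have := ht.eventually hm
      simpa [IsLocalMax, IsMaxFilter] using this
  have hs : ∑ i, ((∑ j, a j * pd i (fun y => pd i v y j) z) + ε * 2) ≤ 0 :=
    Finset.sum_nonpos fun i _ => key i
  rw [Finset.sum_add_distrib, Finset.sum_comm] at hs
  simp_rw [← Finset.mul_sum, lap_comp v hv hdiv z hc] at hs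
  simp at hs
  linarith

lemma norm_le_of_bound (v : E3 → E3) (hv : ContDiff ℝ 2 v) (hdiv : ∀ x, div3 v x = 0)
    (hvan : Tendsto v (cocompact E3) (𝓝 0)) (M : ℝ) (hM : 0 ≤ M)
    (hK : ∀ x ∈ closure {y : E3 | curl3 v y ≠ 0}, ‖v x‖ ≤ M) (x0 : E3) : ‖v x0‖ ≤ M := by
  by_contra! hx
  set a : E3 := v x0 with ha
  have hinner : ∀ y, ∑ j, a j * v y j = ⟪a, v y⟫ := by
    intro y
    simp [PiLp.inner_apply, mul_comm]
  have hN : 0 < ‖a‖ := lt_of_le_of_lt hM hx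
  obtain ⟨m, hm1, hm2⟩ := exists_between hx
  have hev : ∀ᶠ y in cocompact E3, ‖v y‖ < m := by
    have := hvan.norm
    rw [norm_zero] at this
    exact this.eventually_lt_const (lt_of_le_of_lt hM hm1)
  obtain ⟨R, hR⟩ : ∃ R : ℝ, ∀ y, R ≤ ‖y‖ → ‖v y‖ < m := by
    obtain ⟨S, hS, hS'⟩ := (mem_cocompact.1 hev)
    obtain ⟨r, hr⟩ := hS.isBounded.exists_norm_le
    refine ⟨r + 1, fun y hy => hS' fun hyS => ?_⟩
    have := hr y hyS
    linarith
  have hx0R : ‖x0‖ < R := by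
    by_contra! h
    exact absurd (hR x0 h) (not_lt.2 hm2.le)
  have hRpos : 0 < R := lt_of_le_of_lt (norm_nonneg _) hx0R
  set ε : ℝ := ‖a‖ * (‖a‖ - m) / (2 * R ^ 2) with hεd
  have hε : 0 < ε := by
    have : 0 < ‖a‖ - m := by linarith
    positivity
  have hεR : ε * R ^ 2 < ‖a‖ * (‖a‖ - m) := by
    have h1 : 0 < ‖a‖ * (‖a‖ - m) := mul_pos hN (by linarith)
    have h2 : ε * R ^ 2 = ‖a‖ * (‖a‖ - m) / 2 := by rw [hεd]; field_simp
    linarith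
  have hcont : Continuous (fun y => (∑ j, a j * v y j) + ε * ‖y‖ ^ 2) := by
    simp_rw [hinner]
    have := hv.continuous
    fun_prop
  obtain ⟨z, hzR, hz⟩ := (isCompact_closedBall (0 : E3) R).exists_isMaxOn
    ⟨0, by simp [hRpos.le]⟩ hcont.continuousOn
  have hzR' : ‖z‖ ≤ R := by simpa using hzR
  have hbig : m < ‖v z‖ := by
    have h1 := hz (show x0 ∈ Metric.closedBall (0 : E3) R by simpa using hx0R.le)
    simp only [mem_ofPred_eq, hinner] at h1
    rw [← ha, real_inner_self_eq_norm_sq] at h1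
    have h2 : ⟪a, v z⟫ ≤ ‖a‖ * ‖v z‖ := real_inner_le_norm _ _
    have h3 : ε * ‖z‖ ^ 2 ≤ ε * R ^ 2 := by gcongr
    have h4 : 0 ≤ ε * ‖x0‖ ^ 2 := by positivity
    have h5 : ‖a‖ * m < ‖a‖ * ‖v z‖ := by nlinarith
    exact lt_of_mul_lt_mul_left h5 hN.le
  have hzlt : ‖z‖ < R := by
    by_contra! h
    exact absurd (hR z h) (not_lt.2 hbig.le)
  have hzK : z ∉ closure {y : E3 | curl3 v y ≠ 0} := fun h => by
    have := hK z h
    linarith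
  refine no_local_max_s6 v hv hdiv z a ?_ ε hε ?_
  · filter_upwards [isClosed_closure.isOpen_compl.mem_nhds hzK] with y hy
    by_contra h
    exact hy (subset_closure h)
  · exact hz.isLocalMax (Metric.closedBall_mem_nhds_of_mem (by simpa using hzlt))

/-- For a smooth Navier–Stokes/Euler solution with `u` vanishing at spatial
infinity, the sup of `‖u(t,·)‖` over the zero-vorticity set `Ω_t` is at most its sup over the
closure of `ℝ³ \ Ω_t`, provided `Ω_t ≠ ℝ³`. -/
theorem sup_on_zero_vorticity_le (T : ℝ≥0∞) (hT : 0 < T) (μ : ℝ) (hμ : 0 ≤ μ)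
    (u : ℝ → E3 → E3) (p : ℝ → E3 → ℝ)
    (hsol : IsNSSolution μ T u p)
    (hvan : ∀ t ∈ TimeDom T, Tendsto (u t) (cocompact E3) (𝓝 0))
    (t : ℝ) (ht : t ∈ TimeDom T)
    (hΩ : {y : E3 | curl3 (u t) y = 0} ≠ univ) :
    (⨆ x : {y : E3 | curl3 (u t) y = 0}, ‖u t x.1‖)
      ≤ ⨆ x : closure {y : E3 | curl3 (u t) y ≠ 0}, ‖u t x.1‖ := by
  have hv : ContDiff ℝ 2 (u t) := by
    have h1 : ContDiff ℝ (⊤ : ℕ∞) (u t) := by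
      rw [← contDiffOn_univ]
      exact hsol.1.comp (contDiff_prodMk_right t).contDiffOn (fun x _ => ⟨ht, mem_univ _⟩)
    exact contDiff_infty.1 h1 2
  have hbdd : BddAbove (range fun x : closure {y : E3 | curl3 (u t) y ≠ 0} => ‖u t x.1‖) := by
    obtain ⟨C, hC⟩ : ∃ C, ∀ x, ‖u t x‖ ≤ C := by
      have hev : ∀ᶠ y in cocompact E3, ‖u t y‖ < 1 := by
        have := (hvan t ht).norm
        rw [norm_zero] at this
        exact this.eventually_lt_const one_pos
      obtain ⟨S, hS, hS'⟩ := mem_cocompact.1 hev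
      obtain ⟨C, hC⟩ := hS.exists_bound_of_continuousOn hv.continuous.continuousOn
      refine ⟨max C 1, fun x => ?_⟩
      by_cases hx : x ∈ S
      · exact (hC x hx).trans (le_max_left _ _)
      · exact (le_of_lt (hS' hx)).trans (le_max_right _ _)
    exact ⟨C, by rintro _ ⟨x, rfl⟩; exact hC x⟩
  have hM : 0 ≤ ⨆ x : closure {y : E3 | curl3 (u t) y ≠ 0}, ‖u t x.1‖ :=
    Real.iSup_nonneg fun _ => norm_nonneg _
  refine Real.iSup_le (fun x => ?_) hM
  exact norm_le_of_bound (u t) hv (hsol.2.2.2 t ht) (hvan t ht) _ hM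
    (fun y hy => le_ciSup hbdd ⟨y, hy⟩) x.1
end
end
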